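/- Deterministic EHE (Proposition 2): let A = (Q, q0, δ, ver) be a deterministic and complete specification automaton, and let 𝒱 = 𝒱^n = move([(0, q0) ↦ tt], 0, n) be the EHE constructed with operation move using timestamp encoders ts. Then for every timestamp t occurring in dom 𝒱, every memory ℳ over timestamped atoms, and every state q ∈ Q: if eval(𝒱(t, q), ℳ) = ⊤, then for every state q' ≠ q with (t, q') ∈ dom 𝒱 one has eval(𝒱(t, q'), ℳ) ≠ ⊤. -/

import Mathlib

open Classical

namespace DecSpec

/-- Merge of two dicts (partial functions) with a binary operation `op`. -/
def dmerge {α β : Type*} (op : β → β → β) (f g : α → Option β) : α → Option β :=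
  fun x =>
    match f x, g x with
    | some a, some b => some (op a b)
    | some a, none   => some a
    | none,   some b => some b
    | none,   none   => none

/-- Boolean expressions over atoms `A`. -/
inductive Expr (A : Type*) : Type _ where
  | tt : Expr A
  | ff : Expr A
  | atom : A → Expr A
  | not : Expr A → Expr A
  | and : Expr A → Expr A → Expr A
  | or : Expr A → Expr A → Expr A

/-- Boolean semantics of an expression under a valuation. -/
def Expr.evalv {A : Type*} (v : A → Bool) : Expr A → Bool
  | .tt => true
  | .ff => false
  | .atom a => v a
  | .not e => !(e.evalv v)
  | .and e1 e2 => e1.evalv v && e2.evalv v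
  | .or e1 e2 => e1.evalv v || e2.evalv v

/-- Semantic equivalence of expressions. -/
def Expr.equiv {A : Type*} (e e' : Expr A) : Prop := ∀ v, e.evalv v = e'.evalv v

/-- Apply an encoder to every atom of an expression. -/
def Expr.map {A B : Type*} (f : A → B) : Expr A → Expr B
  | .tt => .tt
  | .ff => .ff
  | .atom a => .atom (f a)
  | .not e => .not (e.map f)
  | .and e1 e2 => .and (e1.map f) (e2.map f)
  | .or e1 e2 => .or (e1.map f) (e2.map f)

/-- The set of atoms occurring in an expression. -/
def Expr.atoms {A : Type*} : Expr A → Set A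
  | .tt => ∅
  | .ff => ∅
  | .atom a => {a}
  | .not e => e.atoms
  | .and e1 e2 => e1.atoms ∪ e2.atoms
  | .or e1 e2 => e1.atoms ∪ e2.atoms

/-- The three-valued verdict domain 𝔹₃ = {⊤, ⊥, ?}. -/
inductive Verdict : Type where
  | vt | vf | vna
deriving DecidableEq

/-- A memory is a partial function from atoms to verdicts. -/
abbrev Mem (A : Type*) := A → Option Verdict

/-- The empty memory. -/
def emptyMem {A : Type*} : Mem A := fun _ => none

/-- Rewrite an expression using a memory: replace atoms carrying final verdicts. -/
def Expr.rw {A : Type*} (M : Mem A) : Expr A → Expr A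
  | .tt => .tt
  | .ff => .ff
  | .atom a =>
    match M a with
    | some .vt => .tt
    | some .vf => .ff
    | _ => .atom a
  | .not e => .not (e.rw M)
  | .and e1 e2 => .and (e1.rw M) (e2.rw M)
  | .or e1 e2 => .or (e1.rw M) (e2.rw M)

def Expr.tautology {A : Type*} (e : Expr A) : Prop := ∀ v, e.evalv v = true
def Expr.unsat {A : Type*} (e : Expr A) : Prop := ∀ v, e.evalv v = false

/-- Evaluate an expression against a memory: ⊤ if the rewrite is a tautology,
⊥ if it is unsatisfiable, ? otherwise. -/
noncomputable def evalM {A : Type*} (e : Expr A) (M : Mem A) : Verdict :=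
  if (e.rw M).tautology then .vt
  else if (e.rw M).unsat then .vf
  else .vna

/-- A valuation is consistent with a memory. -/
def consistent {A : Type*} (v : A → Bool) (M : Mem A) : Prop :=
  (∀ a, M a = some .vt → v a = true) ∧ (∀ a, M a = some .vf → v a = false)

/-- An event assigns at most one final verdict (modeled as a `Bool`) to each
atomic proposition. -/
abbrev Event (AP : Type*) := AP → Option Bool

def Event.nonempty {AP : Type*} (evt : Event AP) : Prop := ∃ ap, evt ap ≠ none

/-- Final verdicts as verdicts. -/
def b2v : Bool → Verdict := fun b => if b then .vt else .vf

/-- `cons(evt, id)`: the memory over `AP` built from an event with the identity encoder. -/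
def consId {AP : Type*} (evt : Event AP) : Mem AP := fun ap => (evt ap).map b2v

/-- The timestamp encoder `ts_t`. -/
def tsEnc {AP : Type*} (t : ℕ) (ap : AP) : ℕ × AP := (t, ap)

/-- `⊎²_{t ∈ [1, i]} cons(evt_t, ts_t)`: the memory over timestamped atoms built
from the events at timestamps `1, …, i` with the timestamp encoders. -/
def tsMem {AP : Type*} (evts : ℕ → Event AP) (i : ℕ) : Mem (ℕ × AP) :=
  fun p => if 1 ≤ p.1 ∧ p.1 ≤ i then (evts p.1 p.2).map b2v else none

/-- A specification (Moore) automaton. -/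
structure SpecAut (AP : Type*) (Q : Type*) where
  q0 : Q
  δ : Q → Expr AP → Option Q
  ver : Q → Verdict

variable {AP Q : Type*}

/-- At most one labeled transition between each ordered pair of states. -/
def SpecAut.UniqueLabels (A : SpecAut AP Q) : Prop :=
  ∀ q q' e e', A.δ q e = some q' → A.δ q e' = some q' → e = e'

/-- Determinism: for every state and memory at most one outgoing label
evaluates to ⊤. -/
def SpecAut.Deterministic (A : SpecAut AP Q) : Prop :=
  ∀ (q : Q) (M : Mem AP) (e1 e2 : Expr AP) (q1 q2 : Q),
    A.δ q e1 = some q1 → A.δ q e2 = some q2 →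
    evalM e1 M = .vt → evalM e2 M = .vt → e1 = e2

/-- Completeness: for every state the disjunction of the outgoing labels is a
tautology. -/
def SpecAut.Complete (A : SpecAut AP Q) : Prop :=
  ∀ (q : Q) (v : AP → Bool), ∃ (e : Expr AP) (q' : Q),
    A.δ q e = some q' ∧ e.evalv v = true

/-- The transition function `Δ` over events. -/
noncomputable def SpecAut.step (A : SpecAut AP Q) (q : Q) (evt : Event AP) : Q :=
  if h : evt.nonempty ∧ ∃ (q' : Q) (e : Expr AP),
      A.δ q e = some q' ∧ evalM e (consId evt) = .vt
  then h.2.choose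
  else q

/-- `Δ*`: the extension of `Δ` to finite sequences of events. -/
noncomputable def SpecAut.run (A : SpecAut AP Q) (q : Q) : List (Event AP) → Q
  | [] => q
  | evt :: rest => A.run (A.step q evt) rest

/-- An Execution History Encoding of `A`. -/
abbrev EHE (AP : Type*) (Q : Type*) := ℕ × Q → Option (Expr (ℕ × AP))

/-- EHE merge `⊎∨`: disjoin expressions at keys in both domains. -/
def eheMerge {AP Q : Type*} (V1 V2 : EHE AP Q) : EHE AP Q := dmerge Expr.or V1 V2

/-- `to(𝒱, t, q', enc)`: disjunction of `𝒱(t, q) ∧ enc(e')` over all `(q, e')`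
with `(t, q) ∈ dom 𝒱` and `δ(q, e') = some q'`. -/
noncomputable def toExpr [Fintype Q] (A : SpecAut AP Q) (V : EHE AP Q) (t : ℕ)
    (q' : Q) (enc : AP → ℕ × AP) : Expr (ℕ × AP) :=
  (Finset.univ : Finset Q).toList.foldr
    (fun q acc =>
      match V (t, q) with
      | none => acc
      | some eV =>
        if h : ∃ e', A.δ q e' = some q' then .or (.and eV (h.choose.map enc)) acc
        else acc)
    .ff

/-- States having a transition from some state in the domain of `𝒱` at `t`. -/
def nextStates (A : SpecAut AP Q) (V : EHE AP Q) (t : ℕ) (q' : Q) : Prop :=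
  ∃ (q : Q) (e' : Expr AP), V (t, q) ≠ none ∧ A.δ q e' = some q'

/-- One step of `move`: `𝒱 ↦ 𝒱 ⊎∨ ⨄∨_{q'} [(t+1, q') ↦ to(𝒱, t, q', ts_{t+1})]`. -/
noncomputable def moveStep [Fintype Q] (A : SpecAut AP Q) (V : EHE AP Q) (t : ℕ) :
    EHE AP Q :=
  eheMerge V (fun p =>
    if p.1 = t + 1 ∧ nextStates A V t p.2
    then some (toExpr A V t p.2 (tsEnc (t + 1)))
    else none)

noncomputable def moveN [Fintype Q] (A : SpecAut AP Q) (V : EHE AP Q) (t0 : ℕ) :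
    ℕ → EHE AP Q
  | 0 => V
  | k + 1 => moveStep A (moveN A V t0 k) (t0 + k)

/-- `move(𝒱, t_s, t_e)`. -/
noncomputable def move [Fintype Q] (A : SpecAut AP Q) (V : EHE AP Q) (ts te : ℕ) :
    EHE AP Q :=
  moveN A V ts (te - ts)

/-- The initial EHE `[(0, q0) ↦ tt]`. -/
noncomputable def initEHE (A : SpecAut AP Q) : EHE AP Q :=
  fun p => if p = (0, A.q0) then some .tt else none

/-- `reach(𝒱, ℳ, t)`: the state whose expression at `t` evaluates to ⊤, if any. -/
noncomputable def reach {AP Q : Type*} (V : EHE AP Q) (M : Mem (ℕ × AP)) (t : ℕ) :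
    Option Q :=
  if h : ∃ (q : Q) (e : Expr (ℕ × AP)), V (t, q) = some e ∧ evalM e M = .vt
  then some h.choose
  else none

/-- `inc(𝒱, ℳ)`: incorporate a memory into an EHE by rewriting every entry. -/
def inc {κ A : Type*} (V : κ → Option (Expr A)) (M : Mem A) : κ → Option (Expr A) :=
  fun k => (V k).map (Expr.rw M)

/-- Two memories have no conflicting observations. -/
def noConflict {A : Type*} (M1 M2 : Mem A) : Prop :=
  ∀ a v1 v2, M1 a = some v1 → M2 a = some v2 → v1 = v2

/-- A fixed linear order on verdicts (for memory merge `⊎²`). -/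
def Verdict.rank : Verdict → ℕ
  | .vna => 0
  | .vf => 1
  | .vt => 2

/-- Maximum of two verdicts under the fixed linear order. -/
def vmax (a b : Verdict) : Verdict := if a.rank ≤ b.rank then b else a

/-- Memory merge `⊎²`: keep the larger verdict at common keys. -/
def memMerge {A : Type*} (M1 M2 : Mem A) : Mem A := dmerge vmax M1 M2


/-- The valuation `v` overridden by the memory `M`. -/
def ovr {A : Type*} (M : Mem A) (v : A → Bool) : A → Bool := fun a =>
  match M a with
  | some .vt => true
  | some .vf => false
  | _ => v a

theorem evalv_rw {A : Type*} (M : Mem A) (v : A → Bool) (e : Expr A) :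
    (e.rw M).evalv v = e.evalv (ovr M v) := by
  induction e with
  | tt => rfl
  | ff => rfl
  | atom a =>
    simp only [Expr.rw, Expr.evalv, ovr]
    split <;> simp_all [Expr.evalv]
  | not e ih => simp [Expr.rw, Expr.evalv, ih]
  | and e1 e2 ih1 ih2 => simp [Expr.rw, Expr.evalv, ih1, ih2]
  | or e1 e2 ih1 ih2 => simp [Expr.rw, Expr.evalv, ih1, ih2]

theorem evalv_map {A B : Type*} (f : A → B) (v : B → Bool) (e : Expr A) :
    (e.map f).evalv v = e.evalv (fun a => v (f a)) := by
  induction e with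
  | tt => rfl
  | ff => rfl
  | atom a => rfl
  | not e ih => simp [Expr.map, Expr.evalv, ih]
  | and e1 e2 ih1 ih2 => simp [Expr.map, Expr.evalv, ih1, ih2]
  | or e1 e2 ih1 ih2 => simp [Expr.map, Expr.evalv, ih1, ih2]

theorem evalM_vt {A : Type*} (M : Mem A) (e : Expr A) :
    evalM e M = .vt ↔ ∀ v, e.evalv (ovr M v) = true := by
  have h : evalM e M = .vt ↔ (e.rw M).tautology := by
    unfold evalM
    split_ifs <;> simp_all
  rw [h]
  simp only [Expr.tautology, evalv_rw]

theorem det_val (A : SpecAut AP Q) (hD : A.Deterministic) (q q1 q2 : Q) (e1 e2 : Expr AP)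
    (v : AP → Bool) (h1 : A.δ q e1 = some q1) (h2 : A.δ q e2 = some q2)
    (t1 : e1.evalv v = true) (t2 : e2.evalv v = true) : q1 = q2 := by
  have key : ∀ w, ovr (fun a => some (b2v (v a))) w = v := by
    intro w
    funext a
    cases hv : v a <;> simp [ovr, b2v, hv]
  have he : e1 = e2 := hD q (fun a => some (b2v (v a))) e1 e2 q1 q2 h1 h2
    ((evalM_vt _ _).2 fun w => by rw [key]; exact t1)
    ((evalM_vt _ _).2 fun w => by rw [key]; exact t2)
  subst he
  rw [h1] at h2
  exact Option.some.inj h2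

theorem toExpr_true [Fintype Q] (A : SpecAut AP Q) (V : EHE AP Q) (t : ℕ)
    (q' : Q) (enc : AP → ℕ × AP) (w : ℕ × AP → Bool)
    (h : (toExpr A V t q' enc).evalv w = true) :
    ∃ q eV e, V (t, q) = some eV ∧ A.δ q e = some q' ∧ eV.evalv w = true ∧
      e.evalv (fun a => w (enc a)) = true := by
  unfold toExpr at h
  generalize (Finset.univ : Finset Q).toList = l at h
  induction l with
  | nil => simp [Expr.evalv] at h
  | cons q l ih =>
    simp only [List.foldr_cons] at h
    split at h
    · exact ih h
    · rename_i eV hV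
      split at h
      · rename_i hex
        simp only [Expr.evalv, Bool.or_eq_true, Bool.and_eq_true, evalv_map] at h
        rcases h with h | h
        · exact ⟨q, eV, _, hV, hex.choose_spec, h.1, h.2⟩
        · exact ih h
      · exact ih h

theorem moveN_inv [Fintype Q] (A : SpecAut AP Q) (hD : A.Deterministic) (k : ℕ) :
    (∀ t q, k < t → moveN A (initEHE A) 0 k (t, q) = none) ∧
    (∀ (w : ℕ × AP → Bool) (t : ℕ) (q q' : Q) (e e' : Expr (ℕ × AP)),
      moveN A (initEHE A) 0 k (t, q) = some e →
      moveN A (initEHE A) 0 k (t, q') = some e' →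
      e.evalv w = true → e'.evalv w = true → q = q') := by
  induction k with
  | zero =>
    constructor
    · intro t q ht
      have : t ≠ 0 := by omega
      simp [moveN, initEHE, this]
    · intro w t q q' e e' h h' _ _
      simp only [moveN, initEHE] at h h'
      split_ifs at h h' <;> simp_all
  | succ k ih =>
    obtain ⟨ih1, ih2⟩ := ih
    have old : ∀ t q, t ≠ k + 1 →
        moveN A (initEHE A) 0 (k + 1) (t, q) = moveN A (initEHE A) 0 k (t, q) := by
      intro t q ht
      simp only [moveN, moveStep, eheMerge, dmerge, Nat.zero_add, ht, false_and, if_false]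
      cases moveN A (initEHE A) 0 k (t, q) <;> rfl
    have new : ∀ q e, moveN A (initEHE A) 0 (k + 1) (k + 1, q) = some e →
        e = toExpr A (moveN A (initEHE A) 0 k) k q (tsEnc (k + 1)) := by
      intro q e h
      simp only [moveN, moveStep, eheMerge, dmerge, Nat.zero_add,
        ih1 (k + 1) q (Nat.lt_succ_self k)] at h
      by_cases hn : nextStates A (moveN A (initEHE A) 0 k) k q
      · simp [hn] at h
        exact h.symm
      · simp [hn] at h
    constructor
    · intro t q ht
      rw [old t q (by omega)]
      exact ih1 t q (by omega)
    · intro w t q q' e e' h h' he he'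
      by_cases ht : t = k + 1
      · subst ht
        rw [new q e h] at he
        rw [new q' e' h'] at he'
        obtain ⟨p, f, g, hp, hg, hf, hgt⟩ := toExpr_true _ _ _ _ _ _ he
        obtain ⟨p', f', g', hp', hg', hf', hgt'⟩ := toExpr_true _ _ _ _ _ _ he'
        have hpp := ih2 w k p p' f f' hp hp' hf hf'
        subst hpp
        exact det_val A hD p q q' g g' _ hg hg' hgt hgt'
      · rw [old t _ ht] at h h'
        exact ih2 w t q q' e e' h h' he he'

/-- Proposition 2, deterministic EHE: in the EHE
`𝒱 = move([(0, q0) ↦ tt], 0, n)` constructed with timestamp encoders from a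
deterministic and complete specification automaton, for every timestamp in the
domain and every memory, at most one state can have its expression evaluate
to ⊤. -/
theorem ehe_deterministic {AP Q : Type*} [Fintype AP] [Fintype Q]
    (A : SpecAut AP Q) (hU : A.UniqueLabels) (hD : A.Deterministic)
    (hC : A.Complete) (n : ℕ) :
    ∀ (t : ℕ) (M : Mem (ℕ × AP)) (q q' : Q) (e e' : Expr (ℕ × AP)),
      q ≠ q' →
      move A (initEHE A) 0 n (t, q) = some e →
      move A (initEHE A) 0 n (t, q') = some e' →
      evalM e M = Verdict.vt → evalM e' M ≠ Verdict.vt := by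
  intro t M q q' e e' hne h h' he he'
  exact hne ((moveN_inv A hD _).2 (ovr M fun _ => false) t q q' e e' h h'
    ((evalM_vt _ _).1 he _) ((evalM_vt _ _).1 he' _))

end DecSpec
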